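/- arXiv:2001.04729 — 3 statements merged into one kernel-verified Lean document; each statement's English description precedes it below -/
import Mathlib

section
/- Let L be a positive integer and let S_i = (X^i, T^i, X_0^i, δ^i, Σ^i, ℓ^i), i ∈ [0,L], be finite-state automata. Suppose for each i ∈ [0,L] there is a transition sequence x_0^i →^{s^i} x^i in S_i with x_0^i an initial state and s^i ∈ (T^i)*. If for all i ∈ [1,L] one has ℓ^i(s^0) = ℓ^i(s^i), then in the concurrent composition CC_A(S_0; S_1, …, S_L) there is a transition sequence x_0' →^{s'} x' from an initial state whose j-th component equals the given transition sequence x_0^j →^{s^j} x^j for every j ∈ [0,L]. -/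
namespace DES

/-- Run of a labelled transition system along a finite word of events. -/
inductive RunRel {S : Type*} {E : Type*} (δ : S → E → S → Prop) : S → List E → S → Prop
  | nil (x : S) : RunRel δ x [] x
  | cons {x y z : S} {e : E} {w : List E} :
      δ x e y → RunRel δ y w z → RunRel δ x (e :: w) z

/-- A labelling function (with `none` playing the role of the empty label ε)
extended to words by concatenation (ε's disappear). -/
def obsW {T : Type*} {Λ : Type*} (ℓ : T → Option Λ) (w : List T) : List Λ :=
  w.filterMap ℓ

/-- A finite-state automaton (FSA) `S = (X, T, X₀, δ, Σ, ℓ)`: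
states `X`, events `T`, initial states `init`, transition relation `trans`,
labels `Λ`, labelling function `lbl` (with `none` = ε, i.e. unobservable). -/
structure FSA (X : Type*) (T : Type*) (Λ : Type*) where
  init : Set X
  trans : Set (X × T × X)
  lbl : T → Option Λ

namespace FSA

variable {X : Type*} {T : Type*} {Λ : Type*}

def step (A : FSA X T Λ) (x : X) (t : T) (y : X) : Prop := (x, t, y) ∈ A.trans

/-- extension of the transition relation to words. -/
def Run (A : FSA X T Λ) : X → List T → X → Prop := RunRel A.step

/-- `L(S)`: finite event sequences generated from initial states. -/
def Lang (A : FSA X T Λ) : Set (List T) := {w | ∃ x0 ∈ A.init, ∃ x, A.Run x0 w x}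

def InfRun (A : FSA X T Λ) (x : ℕ → X) (s : ℕ → T) : Prop :=
  x 0 ∈ A.init ∧ ∀ n, A.step (x n) (s n) (x (n + 1))

/-- `L^ω(S)`: infinite event sequences generated from initial states. -/
def LangW (A : FSA X T Λ) : Set (ℕ → T) := {s | ∃ x, A.InfRun x s}

/-- current-state estimate `M_O(S, σ)` under the observation map `O`. -/
def est (A : FSA X T Λ) (O : T → Option Λ) (σ : List Λ) : Set X :=
  {x | ∃ x0 ∈ A.init, ∃ w : List T, obsW O w = σ ∧ A.Run x0 w x}

/-- `y` is reachable from `x` (by a nonempty word). -/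
def Reach (A : FSA X T Λ) (x y : X) : Prop := ∃ w : List T, w ≠ [] ∧ A.Run x w y

/-- `y` lies on a transition cycle. -/
def OnCycle (A : FSA X T Λ) (y : X) : Prop := ∃ w : List T, w ≠ [] ∧ A.Run y w y

/-- the normal sub-automaton: all faulty transitions removed. -/
def normal (A : FSA X T Λ) (Tf : Set T) : FSA X T Λ :=
  ⟨A.init, {tr | tr ∈ A.trans ∧ tr.2.1 ∉ Tf}, A.lbl⟩

/-- local automaton: same data, re-labelled by a local observation map. -/
def localAut (A : FSA X T Λ) (O : T → Option Λ) : FSA X T Λ :=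
  ⟨A.init, A.trans, O⟩

end FSA

/-- local observation map of an observer with observable event set `To`:
it sees the global label on events of `To` and nothing otherwise. -/
noncomputable def localObs {T : Type*} {Λ : Type*} (ℓ : T → Option Λ) (To : Set T) :
    T → Option Λ :=
  fun t => @ite _ (t ∈ To) (Classical.propDecidable _) (ℓ t) none

/-- the first `n` events of an infinite event sequence. -/
def pre {T : Type*} (s : ℕ → T) (n : ℕ) : List T := (List.range n).map s

/-- `s ∈ T*T_f`: the word `s` ends with a faulty event. -/
def endsFaulty {T : Type*} (Tf : Set T) (s : List T) : Prop :=
  ∃ (s₁ : List T) (t : T), t ∈ Tf ∧ s = s₁ ++ [t]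

/-- `T_f ∈ s`: the word `s` contains a faulty event. -/
def hasFault {T : Type*} (Tf : Set T) (s : List T) : Prop := ∃ t ∈ s, t ∈ Tf

namespace FSA

variable {X : Type*} {T : Type*} {Λ : Type*} {L : ℕ}

/-- O-co-detectability (Definition CoDet). -/
def CoDetectable (A : FSA X T Λ) (O : Fin L → T → Option Λ) : Prop :=
  ∃ k : ℕ, ∀ s ∈ A.LangW, ∃ i : Fin L, ∀ n : ℕ,
    k ≤ (obsW (O i) (pre s n)).length →
    (A.est (O i) (obsW (O i) (pre s n))).ncard = 1

/-- strong detectability (Definition StrDet). -/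
def StronglyDetectable (A : FSA X T Λ) : Prop :=
  ∃ k : ℕ, ∀ s ∈ A.LangW, ∀ n : ℕ,
    k ≤ (obsW A.lbl (pre s n)).length →
    (A.est A.lbl (obsW A.lbl (pre s n))).ncard = 1

/-- (O, T_f)-co-diagnosability (Definition CoDiag). -/
def CoDiagnosable (A : FSA X T Λ) (O : Fin L → T → Option Λ) (Tf : Set T) : Prop :=
  ∃ k : ℕ, ∀ s s' : List T, s ∈ A.Lang → endsFaulty Tf s → s ++ s' ∈ A.Lang →
    k ≤ s'.length →
    ∃ i : Fin L, ∀ s'' ∈ A.Lang, obsW (O i) s'' = obsW (O i) (s ++ s') → hasFault Tf s''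

/-- T_f-diagnosability (Definition Diag). -/
def Diagnosable (A : FSA X T Λ) (Tf : Set T) : Prop :=
  ∃ k : ℕ, ∀ s s' : List T, s ∈ A.Lang → endsFaulty Tf s → s ++ s' ∈ A.Lang →
    k ≤ s'.length →
    ∀ s'' ∈ A.Lang, obsW A.lbl s'' = obsW A.lbl (s ++ s') → hasFault Tf s''

/-- (O, T_f)-co-predictability (Definition CoPred). -/
def CoPredictable (A : FSA X T Λ) (O : Fin L → T → Option Λ) (Tf : Set T) : Prop :=
  ∃ k : ℕ, ∀ s ∈ A.Lang, endsFaulty Tf s →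
    ∃ s' : List T, s' <+: s ∧ ¬ hasFault Tf s' ∧
      ∃ i : Fin L, ∀ u v : List T, u ++ v ∈ A.Lang → obsW (O i) s' = obsW (O i) u →
        ¬ hasFault Tf u → k ≤ v.length → hasFault Tf v

/-- T_f-predictability (Definition Pred). -/
def Predictable (A : FSA X T Λ) (Tf : Set T) : Prop :=
  ∃ k : ℕ, ∀ s ∈ A.Lang, endsFaulty Tf s →
    ∃ s' : List T, s' <+: s ∧ ¬ hasFault Tf s' ∧
      ∀ u v : List T, u ++ v ∈ A.Lang → obsW A.lbl s' = obsW A.lbl u →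
        ¬ hasFault Tf u → k ≤ v.length → hasFault Tf v

end FSA

section CC

variable {T : Type*} {Λ : Type*} {L : ℕ}

/-- labelling extended to `Option T` (with `none` = ε). -/
def obsE (ℓ : T → Option Λ) : Option T → Option Λ := fun t? => t?.bind ℓ

/-- one optional step: `none` = stay put, `some t` = take a `t`-transition. -/
def stepOpt {X : Type*} (tr : Set (X × T × X)) : X → Option T → X → Prop :=
  fun x t? y =>
    match t? with
    | none => x = y
    | some t => (x, t, y) ∈ tr

/-- validity of a composite event of the concurrent composition,
restricted to the "active" local components `act`. -/
def ccEventOn (ℓs : Fin L → T → Option Λ) (act : Fin L → Prop)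
    (t0 : Option T) (ts : Fin L → Option T) : Prop :=
  ((∀ j, act j → obsE (ℓs j) t0 = none) ∧
   (∀ j, act j → obsE (ℓs j) (ts j) = none) ∧
   ((t0 ≠ none ∧ ∀ j, act j → ts j = none) ∨
    (t0 = none ∧ ∃ j, act j ∧ ts j ≠ none ∧ ∀ j', act j' → j' ≠ j → ts j' = none)))
  ∨
  ((∃ j, act j ∧ obsE (ℓs j) t0 ≠ none) ∧
   (∀ l, act l →
     (obsE (ℓs l) t0 = none → ts l = none) ∧
     (obsE (ℓs l) t0 ≠ none → obsE (ℓs l) (ts l) = obsE (ℓs l) t0)))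

/-- validity of a composite event of the concurrent composition. -/
def ccEvent (ℓs : Fin L → T → Option Λ) (t0 : Option T) (ts : Fin L → Option T) : Prop :=
  ccEventOn ℓs (fun _ => True) t0 ts

/-- transition relation of the concurrent composition `CC_A(A0; A 0, …, A (L-1))`. -/
def ccTrans {X0 : Type*} {Xs : Fin L → Type*}
    (A0 : FSA X0 T Λ) (A : ∀ i, FSA (Xs i) T Λ) :
    (X0 × (∀ i, Xs i)) → (Option T × (Fin L → Option T)) → (X0 × (∀ i, Xs i)) → Prop :=
  fun p e q =>
    ccEvent (fun i => (A i).lbl) e.1 e.2 ∧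
    stepOpt A0.trans p.1 e.1 q.1 ∧
    ∀ i, stepOpt (A i).trans (p.2 i) (e.2 i) (q.2 i)

/-- initial states of the concurrent composition. -/
def ccInit {X0 : Type*} {Xs : Fin L → Type*}
    (A0 : FSA X0 T Λ) (A : ∀ i, FSA (Xs i) T Λ) : Set (X0 × (∀ i, Xs i)) :=
  {p | p.1 ∈ A0.init ∧ ∀ i, p.2 i ∈ (A i).init}

end CC

section Dia

/-- events of the ⋄-variant of the concurrent composition: ε, an event of `T`,
or the fresh event ⋄. -/
inductive DEv (T : Type*) where
  | eps : DEv T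
  | ev : T → DEv T
  | dia : DEv T

variable {X : Type*} {T : Type*} {Λ : Type*} {L : ℕ}

def devOf : Option T → DEv T
  | none => DEv.eps
  | some t => DEv.ev t

def devToOpt : DEv T → Option T
  | DEv.ev t => some t
  | _ => none

/-- transition relation of the variant concurrent composition
`CC_A^⋄(S; S_1, …, S_L)` of an FSA `A` with its local automata given by the
local observation maps `O i`.  A local component equal to `none` is the fresh
state ⋄. -/
def diaTrans (A : FSA X T Λ) (O : Fin L → T → Option Λ) :
    (X × (Fin L → Option X)) → (Option T × (Fin L → DEv T)) →
    (X × (Fin L → Option X)) → Prop :=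
  fun p e q =>
    -- an ordinary transition of the concurrent composition (all components in X)
    ((∃ ts : Fin L → Option T,
        (∀ i, e.2 i = devOf (ts i)) ∧
        ccEvent O e.1 ts ∧
        stepOpt A.trans p.1 e.1 q.1 ∧
        (∀ i, ∃ xi yi, p.2 i = some xi ∧ q.2 i = some yi ∧ stepOpt A.trans xi (ts i) yi)))
    ∨
    -- the extra ⋄-transitions, at states with some component differing from the 0-th
    ((∃ i, p.2 i ≠ some p.1) ∧
     (∀ i, p.2 i ≠ some p.1 → e.2 i = DEv.dia ∧ q.2 i = none) ∧
     (∃ ts : Fin L → Option T,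
        (∀ i, p.2 i = some p.1 → e.2 i = devOf (ts i)) ∧
        ((ccEventOn O (fun i => p.2 i = some p.1) e.1 ts ∧
          stepOpt A.trans p.1 e.1 q.1 ∧
          (∀ i, p.2 i = some p.1 → ∃ yi, q.2 i = some yi ∧ stepOpt A.trans p.1 (ts i) yi))
         ∨
         (e.1 = none ∧ q.1 = p.1 ∧
          (∀ i, p.2 i = some p.1 → ts i = none ∧ q.2 i = some p.1)))))

/-- initial states of the variant concurrent composition. -/
def diaInit (A : FSA X T Λ) : Set (X × (Fin L → Option X)) :=
  {p | p.1 ∈ A.init ∧ ∀ i, ∃ z ∈ A.init, p.2 i = some z}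

end Dia

/-- a (possibly partial) deterministic finite automaton. -/
structure PDFA (Q : Type*) (A : Type*) where
  start : Q
  accept : Set Q
  trans : Set (Q × A × Q)
  deterministic : ∀ q a q' q'', (q, a, q') ∈ trans → (q, a, q'') ∈ trans → q' = q''

namespace PDFA

variable {Q : Type*} {A : Type*}

def step (M : PDFA Q A) (q : Q) (a : A) (q' : Q) : Prop := (q, a, q') ∈ M.trans

def Accepts (M : PDFA Q A) (w : List A) : Prop :=
  ∃ q, RunRel M.step M.start w q ∧ q ∈ M.accept

def Acyclic (M : PDFA Q A) : Prop := ¬ ∃ (q : Q) (w : List A), w ≠ [] ∧ RunRel M.step q w q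

def Complete (M : PDFA Q A) : Prop := ∀ q a, ∃ q', (q, a, q') ∈ M.trans

def Deadlock (M : PDFA Q A) (q : Q) : Prop := ∀ a q', (q, a, q') ∉ M.trans

def DeadlockFree (M : PDFA Q A) : Prop := ∀ q, ∃ a q', (q, a, q') ∈ M.trans

end PDFA

end DES
open DES in
theorem lift_aux
    {X0 : Type*} {T : Type*} {Λ : Type*} {L : ℕ} {Xs : Fin L → Type*}
    (A0 : FSA X0 T Λ) (A : ∀ i, FSA (Xs i) T Λ) (xf0 : X0) (xfs : ∀ i, Xs i) (n : ℕ) :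
    ∀ (x00 : X0) (xs0 : ∀ i, Xs i)
    (s0 : List T) (ss : ∀ _ : Fin L, List T)
    (_ : s0.length + ∑ i, (ss i).length = n)
    (_ : A0.Run x00 s0 xf0) (_ : ∀ i, (A i).Run (xs0 i) (ss i) (xfs i))
    (_ : ∀ i, obsW ((A i).lbl) s0 = obsW ((A i).lbl) (ss i)),
    ∃ s' : List (Option T × (Fin L → Option T)),
      RunRel (ccTrans A0 A) (x00, xs0) s' (xf0, xfs) ∧
      s'.filterMap (fun e => e.1) = s0 ∧
      ∀ i, s'.filterMap (fun e => e.2 i) = ss i := by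
  induction n using Nat.strong_induction_on with
  | _ n ih =>
  intro x00 xs0 s0 ss hn hr0 hrs hobs
  by_cases hun : ∃ i t w, ss i = t :: w ∧ (A i).lbl t = none
  · obtain ⟨i, t, w, hi, hl⟩ := hun
    have hri := hrs i
    rw [hi] at hri
    cases hri with
    | @cons _ y _ _ _ hst hrun =>
    have hlen : ∑ j, (Function.update ss i w j).length < ∑ j, (ss j).length := by
      apply Finset.sum_lt_sum
      · intro j _
        by_cases h : j = i
        · subst h; simp [hi]
        · simp [h]
      · exact ⟨i, Finset.mem_univ _, by simp [hi]⟩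
    obtain ⟨s', h1, h2, h3⟩ := ih (s0.length + ∑ j, (Function.update ss i w j).length)
      (by omega) x00 (Function.update xs0 i y) s0 (Function.update ss i w) rfl hr0
      (by
        intro j
        by_cases h : j = i
        · subst h; simpa [FSA.Run] using hrun
        · simpa [h] using hrs j)
      (by
        intro j
        by_cases h : j = i
        · subst h
          have := hobs j
          rw [hi] at this
          simpa [obsW, hl] using this
        · simpa [h] using hobs j)
    refine ⟨(none, Function.update (fun _ => none) i (some t)) :: s',
      RunRel.cons ?_ h1, by simpa using h2, ?_⟩
    · refine ⟨Or.inl ⟨by simp [obsE], ?_, Or.inr ⟨rfl, i, trivial, by simp, ?_⟩⟩, rfl, ?_⟩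
      · intro j _
        by_cases h : j = i
        · subst h; simpa [obsE] using hl
        · simp [h, obsE]
      · intro j _ h
        simp [h]
      · intro j
        by_cases h : j = i
        · subst h; simpa [stepOpt, FSA.step] using hst
        · simp [h, stepOpt]
    · intro j
      by_cases h : j = i
      · subst h
        have := h3 j
        simp only [Function.update_self] at this
        simp [hi, this]
      · have := h3 j
        simp only [Function.update_of_ne h] at this
        simp [h, this]
  · push Not at hun
    cases hr0 with
    | nil =>
      have he : ∀ i, ss i = [] := by
        intro i
        cases hsi : ss i with
        | nil => rfl
        | cons t w =>
          exfalso
          have h1 := hun i t w hsi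
          have h2 := hobs i
          obtain ⟨b, hb⟩ := Option.ne_none_iff_exists'.1 h1
          simp [hsi, obsW, hb] at h2
      have hx : xs0 = xfs := by
        funext i
        have := hrs i
        rw [he i] at this
        generalize xs0 i = a at this
        generalize xfs i = b at this
        cases this
        rfl
      subst hx
      exact ⟨[], RunRel.nil _, rfl, fun i => by simp [he i]⟩
    | @cons _ y0 _ t w0 hst hrun =>
      have key : ∀ i, ∃ (o : Option T) (y : Xs i) (w : List T),
          stepOpt (A i).trans (xs0 i) o y ∧ (A i).Run y w (xfs i) ∧ ss i = o.toList ++ w ∧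
          ((A i).lbl t = none → o = none) ∧
          ((A i).lbl t ≠ none → obsE (A i).lbl o = (A i).lbl t) ∧
          obsW (A i).lbl w0 = obsW (A i).lbl w := by
        intro i
        have ho := hobs i
        cases hlt : (A i).lbl t with
        | none =>
          refine ⟨none, xs0 i, ss i, rfl, hrs i, rfl, fun _ => rfl, fun h => absurd rfl h, ?_⟩
          simpa [obsW, hlt] using ho
        | some a =>
          have hri := hrs i
          cases hsi : ss i with
          | nil => simp [obsW, hlt, hsi] at ho
          | cons u w =>
            obtain ⟨b, hb⟩ := Option.ne_none_iff_exists'.1 (hun i u w hsi)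
            rw [hsi] at hri
            cases hri with
            | @cons _ y _ _ _ hs1 hr1 =>
            simp only [obsW, hlt, hsi, hb, List.filterMap_cons, List.cons.injEq] at ho
            exact ⟨some u, y, w, hs1, hr1, rfl, by simp, by simp [obsE, hb, ho.1], ho.2⟩
      choose o y w k1 k2 k3 k4 k5 k6 using key
      have hlen : ∑ j, (w j).length ≤ ∑ j, (ss j).length := by
        apply Finset.sum_le_sum
        intro j _
        simp [k3 j]
      obtain ⟨s', h1, h2, h3⟩ := ih (w0.length + ∑ j, (w j).length)
        (by simp only [List.length_cons] at hn; omega) y0 y w0 w rfl hrun k2 k6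
      refine ⟨(some t, o) :: s', RunRel.cons (y := (y0, y)) ⟨?_, hst, k1⟩ h1, by simp [h2], ?_⟩
      · by_cases hall : ∀ j, (A j).lbl t = none
        · exact Or.inl ⟨fun j _ => hall j, fun j _ => by simp [k4 j (hall j), obsE],
            Or.inl ⟨by simp, fun j _ => k4 j (hall j)⟩⟩
        · push Not at hall
          obtain ⟨j, hj⟩ := hall
          exact Or.inr ⟨⟨j, trivial, hj⟩, fun l _ => ⟨k4 l, k5 l⟩⟩
      · intro j
        rw [k3 j, List.filterMap_cons]
        cases hoj : o j <;> simp [hoj, h3 j]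

open DES in
/-- Proposition 1: synchronizable runs of the component automata lift to a run
of the concurrent composition `CC_A(S_0; S_1, …, S_L)` whose components are the
given runs. -/
theorem fsa_concurrent_composition_lift
    {X0 : Type*} {T : Type*} {Λ : Type*} {L : ℕ} {Xs : Fin L → Type*}
    [Fintype X0] [∀ i, Fintype (Xs i)] [Fintype T] (hL : 0 < L)
    (A0 : FSA X0 T Λ) (A : ∀ i, FSA (Xs i) T Λ)
    (x00 : X0) (xs0 : ∀ i, Xs i) (xf0 : X0) (xfs : ∀ i, Xs i)
    (s0 : List T) (ss : ∀ _ : Fin L, List T)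
    (h0 : x00 ∈ A0.init) (hs : ∀ i, xs0 i ∈ (A i).init)
    (hr0 : A0.Run x00 s0 xf0) (hrs : ∀ i, (A i).Run (xs0 i) (ss i) (xfs i))
    (hobs : ∀ i, obsW ((A i).lbl) s0 = obsW ((A i).lbl) (ss i)) :
    ∃ s' : List (Option T × (Fin L → Option T)),
      RunRel (ccTrans A0 A) (x00, xs0) s' (xf0, xfs) ∧
      s'.filterMap (fun e => e.1) = s0 ∧
      ∀ i, s'.filterMap (fun e => e.2 i) = ss i := by
  exact lift_aux A0 A xf0 xfs _ x00 xs0 s0 ss rfl hr0 hrs hobs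
end

section
/- An FSA S = (X, T, X_0, δ, Σ, ℓ) is not strongly detectable if and only if in the variant concurrent composition CC_A^⋄(S; S) there exist a reachable state (x_1, x̄_1) with x̄_1 ∈ X that belongs to an observable transition cycle, a state (x_2, ⋄) reachable from (x_1, x̄_1), and a state x_3 ∈ X equal to x_2 or reachable from x_2 in S that belongs to a transition cycle of S. -/
namespace DES

section aux
variable {X : Type*} {T : Type*} {Λ : Type*}

inductive Sync (A : FSA X T Λ) : X → X → List Λ → X → X → Prop
  | nil (x y : X) : Sync A x y [] x y
  | left {x y x1 x' y' : X} {t : T} {σ : List Λ} : A.step x t x1 → A.lbl t = none →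
      Sync A x1 y σ x' y' → Sync A x y σ x' y'
  | right {x y y1 x' y' : X} {t : T} {σ : List Λ} : A.step y t y1 → A.lbl t = none →
      Sync A x y1 σ x' y' → Sync A x y σ x' y'
  | both {x y x1 y1 x' y' : X} {t t' : T} {a : Λ} {σ : List Λ} : A.step x t x1 →
      A.step y t' y1 → A.lbl t = some a → A.lbl t' = some a →
      Sync A x1 y1 σ x' y' → Sync A x y (a :: σ) x' y'

theorem RunRel.append {S E : Type*} {δ : S → E → S → Prop} {x y z : S} {u v : List E}
    (h : RunRel δ x u y) (h' : RunRel δ y v z) : RunRel δ x (u ++ v) z := by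
  induction h with
  | nil => exact h'
  | cons h1 _ ih => exact RunRel.cons h1 (ih h')

theorem Sync.append {A : FSA X T Λ} {x y x' y' x'' y'' : X} {σ τ : List Λ}
    (h : Sync A x y σ x' y') (h' : Sync A x' y' τ x'' y'') :
    Sync A x y (σ ++ τ) x'' y'' := by
  induction h with
  | nil => exact h'
  | left h1 h2 _ ih => exact Sync.left h1 h2 (ih h')
  | right h1 h2 _ ih => exact Sync.right h1 h2 (ih h')
  | both h1 h2 h3 h4 _ ih => exact Sync.both h1 h2 h3 h4 (ih h')

theorem Sync.runs {A : FSA X T Λ} {x y x' y' : X} {σ : List Λ}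
    (h : Sync A x y σ x' y') :
    ∃ u v, A.Run x u x' ∧ A.Run y v y' ∧ obsW A.lbl u = σ ∧ obsW A.lbl v = σ := by
  induction h with
  | nil x y => exact ⟨[], [], RunRel.nil _, RunRel.nil _, rfl, rfl⟩
  | left h1 h2 _ ih =>
    obtain ⟨u, v, hu, hv, e1, e2⟩ := ih
    exact ⟨_ :: u, v, RunRel.cons h1 hu, hv, by simpa [obsW, h2] using e1, e2⟩
  | right h1 h2 _ ih =>
    obtain ⟨u, v, hu, hv, e1, e2⟩ := ih
    exact ⟨u, _ :: v, hu, RunRel.cons h1 hv, e1, by simpa [obsW, h2] using e2⟩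
  | both h1 h2 h3 h4 _ ih =>
    obtain ⟨u, v, hu, hv, e1, e2⟩ := ih
    exact ⟨_ :: u, _ :: v, RunRel.cons h1 hu, RunRel.cons h2 hv,
      by simpa [obsW, h3] using e1, by simpa [obsW, h4] using e2⟩

theorem sync_of_right {A : FSA X T Λ} {x y y' : X} {v : List T} (hv : A.Run y v y')
    (e : obsW A.lbl v = []) : Sync A x y [] x y' := by
  unfold FSA.Run at hv
  induction hv with
  | nil => exact Sync.nil _ _
  | @cons _ _ _ t w h1 _ ih =>
    cases h : A.lbl t with
    | none => exact Sync.right h1 h (ih (by simpa [obsW, h] using e))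
    | some a => simp [obsW, h] at e

theorem split_obs {A : FSA X T Λ} {y y' : X} {v : List T} {a : Λ} {σ : List Λ}
    (hv : A.Run y v y') (e : obsW A.lbl v = a :: σ) :
    ∃ z z' t w, (∀ x, Sync A x y [] x z) ∧ A.step z t z' ∧ A.lbl t = some a ∧
      A.Run z' w y' ∧ obsW A.lbl w = σ := by
  unfold FSA.Run at hv
  induction hv with
  | nil => simp [obsW] at e
  | @cons p q r t w h1 h2 ih =>
    cases h : A.lbl t with
    | none =>
      obtain ⟨z, z', t', w', hs, r⟩ := ih (by simpa [obsW, h] using e)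
      exact ⟨z, z', t', w', fun x => Sync.right h1 h (hs x), r⟩
    | some b =>
      simp [obsW, h] at e
      exact ⟨p, q, t, w, fun x => Sync.nil _ _, h1, by rw [h, e.1], h2, e.2⟩

theorem sync_of_runs {A : FSA X T Λ} {x x' : X} {u : List T} (hu : A.Run x u x') :
    ∀ {y y' : X} {v : List T}, A.Run y v y' → obsW A.lbl v = obsW A.lbl u →
    Sync A x y (obsW A.lbl u) x' y' := by
  unfold FSA.Run at hu
  induction hu with
  | nil => intro y y' v hv e; exact sync_of_right hv e
  | @cons p q r t w h1 h2 ih =>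
    intro y y' v hv e
    cases h : A.lbl t with
    | none =>
      have e' : obsW A.lbl (t :: w) = obsW A.lbl w := by simp [obsW, h]
      rw [e'] at e ⊢
      exact Sync.left h1 h (ih hv e)
    | some a =>
      have e' : obsW A.lbl (t :: w) = a :: obsW A.lbl w := by simp [obsW, h]
      rw [e'] at e ⊢
      obtain ⟨z, z', t', w', hs, h3, h4, h5, h6⟩ := split_obs hv e
      have := Sync.both h1 h3 h h4 (ih h5 h6)
      exact (hs p).append this

theorem Sync.split {A : FSA X T Λ} {x y x' y' : X} {τ : List Λ}
    (h : Sync A x y τ x' y') : ∀ {a σ}, τ = a :: σ →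
    ∃ r : X × X, Sync A x y [a] r.1 r.2 ∧ Sync A r.1 r.2 σ x' y' := by
  induction h with
  | nil => intro a σ e; simp at e
  | left h1 h2 _ ih =>
    intro a σ e
    obtain ⟨r, hr, hr'⟩ := ih e
    exact ⟨r, Sync.left h1 h2 hr, hr'⟩
  | right h1 h2 _ ih =>
    intro a σ e
    obtain ⟨r, hr, hr'⟩ := ih e
    exact ⟨r, Sync.right h1 h2 hr, hr'⟩
  | both h1 h2 h3 h4 h5 ih =>
    intro a σ e
    simp only [List.cons.injEq] at e
    obtain ⟨rfl, rfl⟩ := e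
    exact ⟨(_, _), Sync.both h1 h2 h3 h4 (Sync.nil _ _), h5⟩

theorem Sync.seq {A : FSA X T Λ} {x' y' : X} : ∀ {σ : List Λ} {x y : X},
    Sync A x y σ x' y' →
    ∃ f : ℕ → X × X, f 0 = (x, y) ∧
      (∀ i < σ.length, ∃ τ, τ ≠ [] ∧ Sync A (f i).1 (f i).2 τ (f (i+1)).1 (f (i+1)).2) ∧
      Sync A (f σ.length).1 (f σ.length).2 [] x' y'
  | [], x, y, h => ⟨fun _ => (x, y), rfl, by simp, h⟩
  | a :: σ, x, y, h => by
    obtain ⟨r, hr, hr'⟩ := h.split rfl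
    obtain ⟨f, f0, f1, f2⟩ := Sync.seq hr'
    refine ⟨fun i => Nat.casesOn i (x, y) f, rfl, ?_, f2⟩
    intro i hi
    cases i with
    | zero => exact ⟨[a], by simp, by simpa [f0] using hr⟩
    | succ i => exact f1 i (by simpa using hi)

theorem sync_chain {A : FSA X T Λ} {f : ℕ → X × X} {i : ℕ} : ∀ d,
    (∀ j, i ≤ j → j < i + d → ∃ τ, τ ≠ [] ∧ Sync A (f j).1 (f j).2 τ (f (j+1)).1 (f (j+1)).2) →
    ∃ τ, (d ≠ 0 → τ ≠ []) ∧ Sync A (f i).1 (f i).2 τ (f (i+d)).1 (f (i+d)).2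
  | 0, _ => ⟨[], by simp, Sync.nil _ _⟩
  | d+1, h => by
    obtain ⟨τ, _, hs⟩ := sync_chain d (fun j h1 h2 => h j h1 (by omega))
    obtain ⟨τ', n', hs'⟩ := h (i+d) (by omega) (by omega)
    exact ⟨τ ++ τ', by simp [n'], hs.append hs'⟩

theorem Sync.pigeon {A : FSA X T Λ} [Fintype X] {x y x' y' : X} {σ : List Λ}
    (h : Sync A x y σ x' y') (hl : Fintype.card (X × X) ≤ σ.length) :
    ∃ r : X × X, ∃ σ1 σ2 σ3, Sync A x y σ1 r.1 r.2 ∧ σ2 ≠ [] ∧ Sync A r.1 r.2 σ2 r.1 r.2 ∧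
      Sync A r.1 r.2 σ3 x' y' := by
  obtain ⟨f, f0, f1, f2⟩ := h.seq
  have key : ∃ i j, i < j ∧ j ≤ σ.length ∧ f i = f j := by
    obtain ⟨i, j, hne, he⟩ := Fintype.exists_ne_map_eq_of_card_lt
      (fun i : Fin (σ.length + 1) => f i) (by simp only [Fintype.card_fin]; omega)
    rcases lt_or_gt_of_ne hne with hlt | hlt
    · exact ⟨i, j, hlt, by omega, he⟩
    · exact ⟨j, i, hlt, by omega, he.symm⟩
  obtain ⟨i, j, hij, hj, he⟩ := key
  obtain ⟨τ1, _, h1⟩ := sync_chain (A := A) (f := f) (i := 0) i (fun k _ hk => f1 k (by omega))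
  obtain ⟨τ2, n2, h2⟩ := sync_chain (A := A) (f := f) (i := i) (j - i)
    (fun k _ hk => f1 k (by omega))
  obtain ⟨τ3, _, h3⟩ := sync_chain (A := A) (f := f) (i := j) (σ.length - j)
    (fun k _ hk => f1 k (by omega))
  rw [Nat.add_sub_cancel' hij.le, ← he] at h2
  rw [Nat.add_sub_cancel' hj, ← he] at h3
  rw [f0, Nat.zero_add] at h1
  exact ⟨f i, τ1, τ2, _, h1, n2 (by omega), h2, h3.append f2⟩

theorem Sync.dia {A : FSA X T Λ} {x y x' y' : X} {σ : List Λ} (h : Sync A x y σ x' y') :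
    ∃ w, RunRel (diaTrans A (fun _ : Fin 1 => A.lbl)) (x, fun _ => some y) w
      (x', fun _ => some y') ∧ (σ ≠ [] → ∃ e ∈ w, obsE A.lbl e.1 ≠ none) := by
  induction h with
  | nil x y => exact ⟨[], RunRel.nil _, by simp⟩
  | @left x y x1 x' y' t σ h1 h2 _ ih =>
    obtain ⟨w, hw, ho⟩ := ih
    refine ⟨(some t, fun _ => DEv.eps) :: w, RunRel.cons (y := (x1, fun _ => some y)) (Or.inl ⟨fun _ => none, ?_, ?_, h1, ?_⟩) hw, ?_⟩
    · intro i; rfl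
    · left; simp [obsE, h2]
    · intro i; exact ⟨y, y, rfl, rfl, rfl⟩
    · intro hn; obtain ⟨e, he, he'⟩ := ho hn; exact ⟨e, by simp [he], he'⟩
  | @right x y y1 x' y' t σ h1 h2 _ ih =>
    obtain ⟨w, hw, ho⟩ := ih
    refine ⟨(none, fun _ => DEv.ev t) :: w, RunRel.cons (y := (x, fun _ => some y1)) (Or.inl ⟨fun _ => some t, ?_, ?_, rfl, ?_⟩) hw, ?_⟩
    · intro i; rfl
    · left; simp [obsE, h2]
    · intro i; exact ⟨y, y1, rfl, rfl, h1⟩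
    · intro hn; obtain ⟨e, he, he'⟩ := ho hn; exact ⟨e, by simp [he], he'⟩
  | @both x y x1 y1 x' y' t t' a σ h1 h2 h3 h4 _ ih =>
    obtain ⟨w, hw, ho⟩ := ih
    refine ⟨(some t, fun _ => DEv.ev t') :: w, RunRel.cons (y := (x1, fun _ => some y1)) (Or.inl ⟨fun _ => some t', ?_, ?_, h1, ?_⟩) hw, ?_⟩
    · intro i; rfl
    · right; simp [obsE, h3, h4]
    · intro i; exact ⟨y, y1, rfl, rfl, h2⟩
    · intro hn; exact ⟨_, List.mem_cons_self, by simp [obsE, h3]⟩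

theorem dia_step {A : FSA X T Λ} {p q : X × (Fin 1 → Option X)} {e}
    (h : diaTrans A (fun _ : Fin 1 => A.lbl) p e q) :
    (∃ y y' σ, p.2 0 = some y ∧ q.2 0 = some y' ∧ Sync A p.1 y σ q.1 y' ∧
      (obsE A.lbl e.1 ≠ none → σ ≠ [])) ∨
    (p.2 0 ≠ some p.1 ∧ q.2 0 = none ∧ ∃ u, A.Run p.1 u q.1) := by
  rcases h with ⟨ts, _, hc, hs, hl⟩ | ⟨⟨i, hi⟩, hq, ts, _, hd⟩
  · left
    obtain ⟨y, y', hy, hy', hst⟩ := hl 0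
    rcases hc with ⟨c1, c2, c3⟩ | ⟨⟨j, _, c1⟩, c2⟩
    · have c1 := c1 0 trivial
      have c2 := c2 0 trivial
      refine ⟨y, y', [], hy, hy', ?_, fun hh => absurd c1 hh⟩
      rcases c3 with ⟨d1, d2⟩ | ⟨d1, j, _, d2, _⟩
      · have d2 := d2 0 trivial
        rw [d2] at hst
        cases hst
        cases he : e.1 with
        | none => exact absurd he d1
        | some t =>
          rw [he] at hs c1
          exact Sync.left hs (by simpa [obsE] using c1) (Sync.nil _ _)
      · rw [d1] at hs
        have hs : p.1 = q.1 := hs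
        rw [← hs]
        rw [Subsingleton.elim j 0] at d2
        cases he : ts 0 with
        | none => exact absurd he d2
        | some t =>
          rw [he] at hst c2
          exact Sync.right hst (by simpa [obsE] using c2) (Sync.nil _ _)
    · have c2 := (c2 0 trivial).2 c1
      cases he : e.1 with
      | none => simp [he, obsE] at c1
      | some t =>
        rw [he] at hs c1 c2
        cases ht : A.lbl t with
        | none => simp [obsE, ht] at c1
        | some a =>
          cases he' : ts 0 with
          | none => simp [obsE, ht, he'] at c2
          | some t' =>
            rw [he'] at hst c2
            exact ⟨y, y', [a], hy, hy', Sync.both hs hst ht (by simpa [obsE, ht] using c2)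
              (Sync.nil _ _), by simp⟩
  · right
    rw [Subsingleton.elim i 0] at hi
    refine ⟨hi, (hq 0 hi).2, ?_⟩
    rcases hd with ⟨_, hs, _⟩ | ⟨_, hs, _⟩
    · cases he : e.1 with
      | none =>
        rw [he] at hs
        have hs : p.1 = q.1 := hs
        rw [← hs]; exact ⟨[], RunRel.nil _⟩
      | some t =>
        rw [he] at hs
        exact ⟨[t], RunRel.cons hs (RunRel.nil _)⟩
    · rw [hs]; exact ⟨[], RunRel.nil _⟩

theorem dia_run_some {A : FSA X T Λ} {p q : X × (Fin 1 → Option X)} {w}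
    (h : RunRel (diaTrans A (fun _ : Fin 1 => A.lbl)) p w q) :
    ∀ {y'}, q.2 0 = some y' → ∃ y σ, p.2 0 = some y ∧ Sync A p.1 y σ q.1 y' ∧
      ((∃ e ∈ w, obsE A.lbl e.1 ≠ none) → σ ≠ []) := by
  induction h with
  | nil p => intro y' hy; exact ⟨y', [], hy, Sync.nil _ _, by simp⟩
  | @cons p r q e w h1 _ ih =>
    intro y' hy
    obtain ⟨z, σ, hz, hs, hσ⟩ := ih hy
    rcases dia_step h1 with ⟨y, z', τ, hy, hz', hs', hτ⟩ | ⟨_, hn, _⟩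
    · rw [hz] at hz'
      cases hz'
      refine ⟨y, τ ++ σ, hy, hs'.append hs, ?_⟩
      rintro ⟨e', he', ho⟩
      rcases List.mem_cons.1 he' with rfl | he'
      · simp [hτ ho]
      · simp [hσ ⟨e', he', ho⟩]
    · rw [hz] at hn; cases hn

theorem dia_run_none {A : FSA X T Λ} {p q : X × (Fin 1 → Option X)} {w}
    (h : RunRel (diaTrans A (fun _ : Fin 1 => A.lbl)) p w q) :
    q.2 0 = none → (p.2 0 = none ∧ ∃ u, A.Run p.1 u q.1) ∨
      ∃ y x' y' σ u, p.2 0 = some y ∧ Sync A p.1 y σ x' y' ∧ x' ≠ y' ∧ A.Run x' u q.1 := by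
  induction h with
  | nil p => intro hy; exact Or.inl ⟨hy, [], RunRel.nil _⟩
  | @cons p r q e w h1 _ ih =>
    intro hq
    rcases dia_step h1 with ⟨y, z', τ, hy, hz', hs', hτ⟩ | ⟨hp, hn, u, hu⟩
    · rcases ih hq with ⟨hr, _⟩ | ⟨z, x', y', σ, u, hz, hs, hne, hu⟩
      · rw [hr] at hz'; cases hz'
      · rw [hz] at hz'
        cases hz'
        exact Or.inr ⟨y, x', y', _, u, hy, hs'.append hs, hne, hu⟩
    · rcases ih hq with ⟨hr, u', hu'⟩ | ⟨z, x', y', σ, u, hz, hs, hne, hu⟩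
      · cases hpp : p.2 0 with
        | none => exact Or.inl ⟨rfl, _, hu.append hu'⟩
        | some y =>
          refine Or.inr ⟨y, p.1, y, [], _, rfl, Sync.nil _ _, ?_, hu.append hu'⟩
          rintro rfl
          exact hp hpp
      · rw [hz] at hn; cases hn

theorem inf_of_cycle {A : FSA X T Λ} {x x3 : X} (hc : A.OnCycle x3) {u : List T}
    (hu : A.Run x u x3) :
    ∃ (f : ℕ → X) (s : ℕ → T), f 0 = x ∧ ∀ n, A.step (f n) (s n) (f (n+1)) := by
  have hstep : ∀ z : {z : X // ∃ u, A.Run z u x3}, ∃ (tz : T × {z : X // ∃ u, A.Run z u x3}),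
      A.step z.1 tz.1 tz.2.1 := by
    rintro ⟨z, u, hu⟩
    have : ∃ u, u ≠ [] ∧ A.Run z u x3 := by
      cases hu with
      | nil => exact hc
      | cons h1 h2 => exact ⟨_ :: _, by simp, RunRel.cons h1 h2⟩
    obtain ⟨v, hv, hr⟩ := this
    cases hr with
    | nil => exact absurd rfl hv
    | @cons _ y _ t w h1 h2 => exact ⟨(t, ⟨y, w, h2⟩), h1⟩
  choose g hg using hstep
  let F : ℕ → {z : X // ∃ u, A.Run z u x3} := fun n => (fun z => (g z).2)^[n] ⟨x, u, hu⟩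
  refine ⟨fun n => (F n).1, fun n => (g (F n)).1, rfl, fun n => ?_⟩
  have : F (n+1) = (g (F n)).2 := Function.iterate_succ_apply' _ _ _
  simp only [this]
  exact hg _

theorem pre_succ_cons (t : T) (s : ℕ → T) (n : ℕ) :
    pre (fun i => Nat.casesOn i t s) (n+1) = t :: pre s n := by
  simp only [pre, List.range_succ_eq_map, List.map_cons, List.map_map]
  rfl

theorem inf_prepend {A : FSA X T Λ} {x0 x : X} {u : List T} (hu : A.Run x0 u x)
    (h : ∃ (f : ℕ → X) (s : ℕ → T), f 0 = x ∧ ∀ n, A.step (f n) (s n) (f (n+1))) :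
    ∃ (f : ℕ → X) (s : ℕ → T), f 0 = x0 ∧ (∀ n, A.step (f n) (s n) (f (n+1))) ∧
      pre s u.length = u := by
  unfold FSA.Run at hu
  induction hu with
  | nil => obtain ⟨f, s, h0, h1⟩ := h; exact ⟨f, s, h0, h1, rfl⟩
  | @cons p q r t w h1 h2 ih =>
    obtain ⟨f, s, h0, hs, hp⟩ := ih h
    refine ⟨fun i => Nat.casesOn i p f, fun i => Nat.casesOn i t s, rfl, ?_, ?_⟩
    · intro n
      cases n with
      | zero => simpa [h0] using h1
      | succ n => exact hs n
    · rw [List.length_cons, pre_succ_cons, hp]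

theorem run_seg {A : FSA X T Λ} {f : ℕ → X} {s : ℕ → T}
    (h : ∀ n, A.step (f n) (s n) (f (n+1))) (i : ℕ) : ∀ d,
    ∃ u, u.length = d ∧ A.Run (f i) u (f (i+d))
  | 0 => ⟨[], rfl, RunRel.nil _⟩
  | d+1 => by
    obtain ⟨u, hu, hr⟩ := run_seg h i d
    exact ⟨u ++ [s (i+d)], by simp [hu], hr.append (RunRel.cons (h _) (RunRel.nil _))⟩

theorem run_pre {A : FSA X T Λ} {f : ℕ → X} {s : ℕ → T}
    (h : ∀ n, A.step (f n) (s n) (f (n+1))) : ∀ n, A.Run (f 0) (pre s n) (f n)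
  | 0 => RunRel.nil _
  | n+1 => by
    have : pre s (n+1) = pre s n ++ [s n] := by simp [pre, List.range_succ]
    rw [this]
    exact (run_pre h n).append (RunRel.cons (h _) (RunRel.nil _))

theorem Sync.pump {A : FSA X T Λ} {x y : X} {σ : List Λ} (h : Sync A x y σ x y)
    (hσ : σ ≠ []) : ∀ k : ℕ, ∃ τ : List Λ, k ≤ τ.length ∧ Sync A x y τ x y
  | 0 => ⟨[], by simp, Sync.nil _ _⟩
  | k+1 => by
    obtain ⟨τ, hk, hs⟩ := Sync.pump h hσ k
    refine ⟨τ ++ σ, ?_, hs.append h⟩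
    have := List.length_pos_of_ne_nil hσ
    simp; omega

end aux

end DES

open DES in
/-- Theorem 4 (criterion): an FSA is not strongly detectable iff in
`CC_A^⋄(S; S)` there are a reachable state `(x_1, x̄_1)` with `x̄_1 ∈ X` lying
on an observable transition cycle, a state `(x_2, ⋄)` reachable from it, and a
state `x_3` equal to `x_2` or reachable from `x_2` in `S` lying on a transition
cycle of `S`. -/
theorem not_stronglyDetectable_iff_dia_witness
    {X : Type*} {T : Type*} {Λ : Type*} [Fintype X] [Fintype T]
    (A : FSA X T Λ) :
    ¬ A.StronglyDetectable ↔
    ∃ (p : X × (Fin 1 → Option X)) (x1bar : X),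
      p.2 0 = some x1bar ∧
      (∃ p0 ∈ diaInit (L := 1) A,
        ∃ w, RunRel (diaTrans A (fun _ : Fin 1 => A.lbl)) p0 w p) ∧
      (∃ c, c ≠ [] ∧ RunRel (diaTrans A (fun _ : Fin 1 => A.lbl)) p c p ∧
        ∃ e ∈ c, obsE A.lbl e.1 ≠ none) ∧
      (∃ x2 : X,
        (∃ w, RunRel (diaTrans A (fun _ : Fin 1 => A.lbl)) p w (x2, fun _ => none)) ∧
        ∃ x3 : X, (x3 = x2 ∨ A.Reach x2 x3) ∧ A.OnCycle x3) := by
  constructor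
  · intro hnd
    unfold FSA.StronglyDetectable at hnd
    push Not at hnd
    obtain ⟨s, ⟨f, hf0, hf⟩, n, hk, hcard⟩ := hnd (Fintype.card (X × X))
    have hrun := run_pre hf n
    have hmem : f n ∈ A.est A.lbl (obsW A.lbl (pre s n)) := ⟨f 0, hf0, _, rfl, hrun⟩
    have hex : ∃ y ∈ A.est A.lbl (obsW A.lbl (pre s n)), f n ≠ y := by
      by_contra hcon
      push Not at hcon
      apply hcard
      rw [Set.ncard_eq_one]
      exact ⟨f n, Set.eq_singleton_iff_unique_mem.2 ⟨hmem, fun y hy => (hcon y hy).symm⟩⟩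
    obtain ⟨y, ⟨y0, hy0, v, hv, hrv⟩, hne⟩ := hex
    obtain ⟨⟨r1, r2⟩, σ1, σ2, σ3, h1, hn2, h2, h3⟩ := (sync_of_runs hrun hrv hv).pigeon hk
    obtain ⟨w1, hw1, _⟩ := h1.dia
    obtain ⟨w2, hw2, ho2⟩ := h2.dia
    obtain ⟨w3, hw3, _⟩ := h3.dia
    refine ⟨(r1, fun _ => some r2), r2, rfl, ⟨(f 0, fun _ => some y0), ⟨hf0, fun _ => ⟨y0, hy0, rfl⟩⟩, w1, hw1⟩,
      ⟨w2, ?_, hw2, ho2 hn2⟩, f n, ⟨w3 ++ [(none, fun _ => DEv.dia)], ?_⟩, ?_⟩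
    · rintro rfl
      simpa using ho2 hn2
    · refine hw3.append (RunRel.cons (Or.inr ?_) (RunRel.nil _))
      have hne' : (some y : Option X) ≠ some (f n) := fun h => hne (Option.some.inj h).symm
      exact ⟨⟨0, hne'⟩, fun i _ => ⟨rfl, rfl⟩, fun _ => none, fun i hi => absurd hi hne',
        Or.inr ⟨rfl, rfl, fun i hi => absurd hi hne'⟩⟩
    · obtain ⟨i, j, hij, he⟩ := Finite.exists_ne_map_eq_of_infinite (fun i => f (n + i))
      have key : ∃ i d, d ≠ 0 ∧ f (n + i) = f (n + i + d) := by
        rcases lt_or_gt_of_ne hij with hlt | hlt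
        · refine ⟨i, j - i, by omega, ?_⟩
          rw [show n + i + (j - i) = n + j by omega]; exact he
        · refine ⟨j, i - j, by omega, ?_⟩
          rw [show n + j + (i - j) = n + i by omega]; exact he.symm
      obtain ⟨i, d, hd, he⟩ := key
      refine ⟨f (n + i), ?_, ?_⟩
      · obtain ⟨u, hu, hr⟩ := run_seg hf n i
        by_cases hi : i = 0
        · left; rw [hi]; rfl
        · right; refine ⟨u, ?_, hr⟩
          rintro rfl; exact hi hu.symm
      · obtain ⟨u, hu, hr⟩ := run_seg hf (n + i) d
        rw [← he] at hr
        refine ⟨u, ?_, hr⟩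
        rintro rfl; exact hd hu.symm
  · rintro ⟨p, y1, hp, ⟨p0, ⟨hp0, hp0'⟩, w, hw⟩, ⟨c, _, hc, hco⟩, x2, ⟨w', hw'⟩, x3, hx3, hcyc⟩ ⟨k, hk⟩
    obtain ⟨y0, σ1, hy0, s1, _⟩ := dia_run_some hw hp
    obtain ⟨y1', σ2, hy1', s2, hn2⟩ := dia_run_some hc hp
    rw [hp] at hy1'
    cases hy1'
    rcases dia_run_none hw' rfl with ⟨hh, _⟩ | ⟨z, x', y', σ3, u, hz, s3, hne, hu⟩
    · rw [hp] at hh; cases hh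
    rw [hp] at hz
    cases hz
    obtain ⟨z0, hz0, hz0'⟩ := hp0' 0
    rw [hy0] at hz0'
    cases hz0'
    obtain ⟨τ, hτ, s2'⟩ := s2.pump (hn2 hco) k
    obtain ⟨a, b, ha, hb, ea, eb⟩ := (s1.append (s2'.append s3)).runs
    have hx3' : ∃ v, A.Run x2 v x3 := by
      rcases hx3 with rfl | ⟨v, _, hv⟩
      · exact ⟨[], RunRel.nil _⟩
      · exact ⟨v, hv⟩
    obtain ⟨v, hv⟩ := hx3'
    obtain ⟨f, s, f0, fs, hpre⟩ := inf_prepend ha (inf_of_cycle hcyc (RunRel.append hu hv))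
    have := hk s ⟨f, by rw [f0]; exact hp0, fs⟩ a.length (by
      rw [hpre, ea]; simp; omega)
    rw [hpre, Set.ncard_eq_one] at this
    obtain ⟨m, hm⟩ := this
    have m1 : x' ∈ A.est A.lbl (obsW A.lbl a) := ⟨_, hp0, a, rfl, ha⟩
    have m2 : y' ∈ A.est A.lbl (obsW A.lbl a) := ⟨_, hz0, b, eb.trans ea.symm, hb⟩
    rw [hm] at m1 m2
    exact hne (m1.trans m2.symm)
end

section
/- Let A_0, A_1, …, A_L be acyclic deterministic finite automata over a common alphabet Σ such that A_0 has exactly one accepting state and all states of each A_i (i ∈ [1,L]) are accepting. Let S be the deterministic FSA constructed from them as described in the context, with local observers O = {O_1, …, O_L}. Then there exists a word w ∈ Σ* accepted by every A_i, i ∈ [0,L], if and only if S is not O-co-detectable. -/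
namespace DES
namespace CoDetRed

variable {L : ℕ} {Alp : Type} {Q : Fin (L + 1) → Type}

/-- states of the reduction FSA: the (disjoint) states of `A_0, …, A_L`
together with the three fresh states `⋄_0 = Sum.inr 0`, `⋄_1 = Sum.inr 1`,
`⋄_2 = Sum.inr 2`. -/
abbrev St (Q : Fin (L + 1) → Type) : Type := (Σ i, Q i) ⊕ Fin 3

/-- events: the renamed letters `σ_i = Sum.inl (i, σ)`, the fresh events
`a_i = Sum.inr (Sum.inl i)` and `a = Sum.inr (Sum.inr ())`. -/
abbrev Ev (L : ℕ) (Alp : Type) : Type := (Fin (L + 1) × Alp) ⊕ (Fin (L + 1) ⊕ Unit)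

/-- labels: `Σ ∪ {a}` with the fresh label `a = Sum.inr ()`. -/
abbrev Lb (Alp : Type) : Type := Alp ⊕ Unit

/-- the (global) labelling: `ℓ(σ_i) = σ`, `ℓ(a_i) = ℓ(a) = a`. -/
def lbl : Ev L Alp → Option (Lb Alp) :=
  fun e => match e with
    | Sum.inl (_, σ) => some (Sum.inl σ)
    | Sum.inr _ => some (Sum.inr ())

/-- the transition relation of the reduction FSA. -/
def trans (M : ∀ i, PDFA (Q i) Alp) : Set (St Q × Ev L Alp × St Q) :=
  {tr |
    -- from `⋄_0` to the former initial state of each `A_i`, labelled `a_i`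
    (∃ i : Fin (L + 1),
      tr = (Sum.inr 0, Sum.inr (Sum.inl i), Sum.inl ⟨i, (M i).start⟩)) ∨
    -- the renamed transitions inside each `A_i`
    (∃ (i : Fin (L + 1)) (σ : Alp) (q q' : Q i), (q, σ, q') ∈ (M i).trans ∧
      tr = (Sum.inl ⟨i, q⟩, Sum.inl (i, σ), Sum.inl ⟨i, q'⟩)) ∨
    -- from the accepting state of `A_0` to `⋄_1`, via event `a`
    (∃ q : Q 0, q ∈ (M 0).accept ∧
      tr = (Sum.inl ⟨0, q⟩, Sum.inr (Sum.inr ()), Sum.inr 1)) ∨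
    -- from each non-accepting state of `A_0` to `⋄_2`, via event `a`
    (∃ q : Q 0, q ∉ (M 0).accept ∧
      tr = (Sum.inl ⟨0, q⟩, Sum.inr (Sum.inr ()), Sum.inr 2)) ∨
    -- from each state of each `A_i`, `i ≥ 1`, to `⋄_2`, via event `a`
    (∃ (i : Fin (L + 1)) (q : Q i), i ≠ 0 ∧
      tr = (Sum.inl ⟨i, q⟩, Sum.inr (Sum.inr ()), Sum.inr 2)) ∨
    -- self-loops on `⋄_1` and `⋄_2`, via event `a`
    tr = (Sum.inr 1, Sum.inr (Sum.inr ()), Sum.inr 1) ∨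
    tr = (Sum.inr 2, Sum.inr (Sum.inr ()), Sum.inr 2)}

/-- the reduction FSA `S`, with unique initial state `⋄_0`. -/
def sys (M : ∀ i, PDFA (Q i) Alp) : FSA (St Q) (Ev L Alp) (Lb Alp) :=
  ⟨{Sum.inr 0}, trans M, lbl⟩

/-- observable event set of the observer in location `i ∈ [1, L]`
(location `i + 1` for `i : Fin L`): `Σ_0 ∪ Σ_i ∪ {a} ∪ {a_j : j ∈ [0, L]}`. -/
def obsSet (i : Fin L) : Set (Ev L Alp) :=
  {e | ∀ (j : Fin (L + 1)) (σ : Alp), e = Sum.inl (j, σ) → (j = 0 ∨ j = i.succ)}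

end CoDetRed
end DES

namespace DES
namespace CoDetRed

variable {L : ℕ} {Alp : Type} {Q : Fin (L + 1) → Type}

abbrev evA : Ev L Alp := Sum.inr (Sum.inr ())

open Classical in
noncomputable def fend (M : ∀ i, PDFA (Q i) Alp) (j : Fin (L + 1)) (q : Q j) : St Q :=
  if j = 0 ∧ q ∈ (M j).accept then Sum.inr 1 else Sum.inr 2

noncomputable def fstate (M : ∀ i, PDFA (Q i) Alp) (j : Fin (L + 1)) (q : Q j) : ℕ → St Q
  | 0 => Sum.inl ⟨j, q⟩
  | _ + 1 => fend M j q

theorem step_inl (M : ∀ i, PDFA (Q i) Alp) (j : Fin (L + 1)) (q : Q j) (e : Ev L Alp) (y : St Q) :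
    (sys M).step (Sum.inl ⟨j, q⟩) e y ↔
      (∃ σ q', (M j).step q σ q' ∧ e = Sum.inl (j, σ) ∧ y = Sum.inl ⟨j, q'⟩) ∨
      (e = evA ∧ y = fend M j q) := by
  constructor
  · intro h
    simp only [FSA.step, sys, trans, Set.mem_setOf_eq, Prod.mk.injEq, Sum.inl.injEq,
      reduceCtorEq, false_and, or_false, exists_false, false_or] at h
    rcases h with ⟨i, σ, q1, q', h, h1, h2, h3⟩ | ⟨q1, h, h1, h2, h3⟩ | ⟨q1, h, h1, h2, h3⟩ |
      ⟨i, q1, h, h1, h2, h3⟩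
    · cases h1
      exact Or.inl ⟨σ, q', h, h2, h3⟩
    · cases h1
      exact Or.inr ⟨h2, by simp [fend, h, h3]⟩
    · cases h1
      exact Or.inr ⟨h2, by simp [fend, h, h3]⟩
    · cases h1
      exact Or.inr ⟨h2, by simp [fend, h, h3]⟩
  · rintro (⟨σ, q', h, rfl, rfl⟩ | ⟨rfl, rfl⟩)
    · exact Or.inr (Or.inl ⟨j, σ, q, q', h, rfl⟩)
    · unfold fend
      by_cases hj : j = 0
      · subst hj
        by_cases hq : q ∈ (M 0).accept
        · exact Or.inr (Or.inr (Or.inl ⟨q, hq, by simp [hq]⟩))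
        · exact Or.inr (Or.inr (Or.inr (Or.inl ⟨q, hq, by simp [hq]⟩)))
      · exact Or.inr (Or.inr (Or.inr (Or.inr (Or.inl ⟨j, q, hj, by simp [hj]⟩))))

theorem step_zero (M : ∀ i, PDFA (Q i) Alp) (e : Ev L Alp) (y : St Q) :
    (sys M).step (Sum.inr 0) e y ↔
      ∃ j, e = Sum.inr (Sum.inl j) ∧ y = Sum.inl ⟨j, (M j).start⟩ := by
  simp [FSA.step, sys, trans]

theorem step_fin (M : ∀ i, PDFA (Q i) Alp) (c : Fin 3) (hc : c ≠ 0) (e : Ev L Alp) (y : St Q) :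
    (sys M).step (Sum.inr c) e y ↔ e = evA ∧ y = Sum.inr c := by
  have : c = 1 ∨ c = 2 := by omega
  rcases this with rfl | rfl <;> simp [FSA.step, sys, trans]

theorem fend_eq (M : ∀ i, PDFA (Q i) Alp) (j : Fin (L + 1)) (q : Q j) :
    ∃ c : Fin 3, c ≠ 0 ∧ fend M j q = Sum.inr c := by
  unfold fend
  split_ifs
  · exact ⟨1, by decide, rfl⟩
  · exact ⟨2, by decide, rfl⟩

theorem run_fin (M : ∀ i, PDFA (Q i) Alp) (c : Fin 3) (hc : c ≠ 0) (t : List (Ev L Alp)) (x : St Q) :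
    (sys M).Run (Sum.inr c) t x ↔ (∃ m, t = List.replicate m evA) ∧ x = Sum.inr c := by
  induction t with
  | nil =>
    constructor
    · intro h
      cases h
      exact ⟨⟨0, rfl⟩, rfl⟩
    · rintro ⟨_, rfl⟩
      exact RunRel.nil _
  | cons e t ih =>
    constructor
    · intro h
      cases h with
      | cons h1 h2 =>
        obtain ⟨rfl, rfl⟩ := (step_fin M c hc _ _).1 h1
        obtain ⟨⟨m, rfl⟩, hx⟩ := ih.1 h2
        exact ⟨⟨m + 1, rfl⟩, hx⟩
    · rintro ⟨⟨m, hm⟩, hx⟩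
      cases m with
      | zero => simp at hm
      | succ m =>
        rw [List.replicate_succ, List.cons.injEq] at hm
        exact RunRel.cons ((step_fin M c hc _ _).2 ⟨hm.1, rfl⟩) (ih.2 ⟨⟨m, hm.2⟩, hx⟩)

def wd (j : Fin (L + 1)) (u : List Alp) (m : ℕ) : List (Ev L Alp) :=
  u.map (fun σ => Sum.inl (j, σ)) ++ List.replicate m evA

theorem run_inl (M : ∀ i, PDFA (Q i) Alp) (j : Fin (L + 1)) (t : List (Ev L Alp)) (q : Q j) (x : St Q) :
    (sys M).Run (Sum.inl ⟨j, q⟩) t x →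
      ∃ u q' m, RunRel (M j).step q u q' ∧ t = wd j u m ∧ x = fstate M j q' m := by
  induction t generalizing q with
  | nil =>
    intro h
    cases h
    exact ⟨[], q, 0, RunRel.nil _, rfl, rfl⟩
  | cons e t ih =>
    intro h
    cases h with
    | cons h1 h2 =>
      rcases (step_inl M j q _ _).1 h1 with ⟨σ, q1, hs, rfl, rfl⟩ | ⟨rfl, rfl⟩
      · obtain ⟨u, q', m, hr, rfl, hx⟩ := ih q1 h2
        exact ⟨σ :: u, q', m, RunRel.cons hs hr, rfl, hx⟩
      · obtain ⟨c, hc, he⟩ := fend_eq M j q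
        rw [he] at h2
        obtain ⟨⟨m, rfl⟩, hx⟩ := (run_fin M c hc _ _).1 h2
        exact ⟨[], q, m + 1, RunRel.nil _, rfl, by rw [hx, ← he]; rfl⟩

theorem run_inl_mk (M : ∀ i, PDFA (Q i) Alp) (j : Fin (L + 1)) (q q' : Q j) (u : List Alp) (m : ℕ)
    (h : RunRel (M j).step q u q') : (sys M).Run (Sum.inl ⟨j, q⟩) (wd j u m) (fstate M j q' m) := by
  induction h with
  | nil q =>
    cases m with
    | zero => exact RunRel.nil _
    | succ m =>
      refine RunRel.cons ((step_inl M j q _ _).2 (Or.inr ⟨rfl, rfl⟩)) ?_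
      obtain ⟨c, hc, he⟩ := fend_eq M j q
      rw [he]
      exact (run_fin M c hc _ _).2 ⟨⟨m, rfl⟩, he⟩
  | cons h1 h2 ih => exact RunRel.cons ((step_inl M j _ _ _).2 (Or.inl ⟨_, _, h1, rfl, rfl⟩)) ih

theorem run_zero (M : ∀ i, PDFA (Q i) Alp) (t : List (Ev L Alp)) (x : St Q)
    (h : (sys M).Run (Sum.inr 0) t x) : t = [] ∨
      ∃ j u q m, RunRel (M j).step (M j).start u q ∧ t = Sum.inr (Sum.inl j) :: wd j u m ∧
        x = fstate M j q m := by
  cases h with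
  | nil => exact Or.inl rfl
  | cons h1 h2 =>
    obtain ⟨j, rfl, rfl⟩ := (step_zero M _ _).1 h1
    obtain ⟨u, q, m, hr, rfl, hx⟩ := run_inl M j _ _ _ h2
    exact Or.inr ⟨j, u, q, m, hr, rfl, hx⟩

theorem run_zero_mk (M : ∀ i, PDFA (Q i) Alp) (j : Fin (L + 1)) (q : Q j) (u : List Alp) (m : ℕ)
    (h : RunRel (M j).step (M j).start u q) :
    (sys M).Run (Sum.inr 0) (Sum.inr (Sum.inl j) :: wd j u m) (fstate M j q m) :=
  RunRel.cons ((step_zero M _ _).2 ⟨j, rfl, rfl⟩) (run_inl_mk M j _ _ u m h)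

open Classical in
noncomputable def vis (i : Fin L) (j : Fin (L + 1)) (u : List Alp) : List Alp :=
  if j = 0 ∨ j = i.succ then u else []

def ow (v : List Alp) (m : ℕ) : List (Lb Alp) :=
  Sum.inr () :: (v.map Sum.inl ++ List.replicate m (Sum.inr ()))

theorem ow_inj {v v' : List Alp} {m m' : ℕ} (h : ow v m = ow v' m') : v = v' ∧ m = m' := by
  have h1 : v = v' := by
    have e : ∀ (v : List Alp) (m : ℕ), List.filterMap Sum.getLeft? (ow v m) = v := by
      intro v m
      unfold ow
      rw [List.filterMap_cons_none rfl, List.filterMap_append, List.filterMap_map,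
        List.filterMap_replicate_of_none rfl, List.append_nil]
      exact List.filterMap_some
    rw [← e v m, h, e]
  refine ⟨h1, ?_⟩
  have := congrArg List.length h
  simp [ow, h1] at this
  exact this

theorem obs_wd (i : Fin L) (j : Fin (L + 1)) (u : List Alp) (m : ℕ) :
    obsW (localObs lbl (obsSet i)) (Sum.inr (Sum.inl j) :: wd j u m) = ow (vis i j u) m := by
  have e1 : ∀ k : Fin (L + 1) ⊕ Unit,
      localObs lbl (obsSet (Alp := Alp) i) (Sum.inr k) = some (Sum.inr ()) := by
    intro k
    simp [localObs, obsSet, lbl]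
  have e2 : ∀ σ : Alp, localObs lbl (obsSet i) (Sum.inl (j, σ)) =
      if j = 0 ∨ j = i.succ then some (Sum.inl σ) else none := by
    intro σ
    have : (Sum.inl (j, σ) : Ev L Alp) ∈ obsSet i ↔ (j = 0 ∨ j = i.succ) := by
      constructor
      · intro h
        exact h j σ rfl
      · intro h j' σ' he
        cases he
        exact h
    unfold localObs
    by_cases hj : j = 0 ∨ j = i.succ
    · rw [if_pos (this.2 hj), if_pos hj]; rfl
    · rw [if_neg (fun h => hj (this.1 h)), if_neg hj]
  unfold obsW wd ow vis
  rw [List.filterMap_cons_some (e1 _), List.filterMap_append, List.filterMap_map]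
  congr 2
  · by_cases hj : j = 0 ∨ j = i.succ
    · rw [if_pos hj]
      simp only [Function.comp_def, e2, if_pos hj]
      simp
    · rw [if_neg hj]
      simp only [Function.comp_def, e2, if_neg hj]
      simp
  · rw [List.filterMap_replicate_of_some (e1 _)]

theorem mem_est (M : ∀ i, PDFA (Q i) Alp) (i : Fin L) (v : List Alp) (m : ℕ) (x : St Q) :
    x ∈ (sys M).est (localObs lbl (obsSet i)) (ow v (m + 1)) ↔
      ∃ j u q, RunRel (M j).step (M j).start u q ∧ vis i j u = v ∧ x = fend M j q := by
  constructor
  · rintro ⟨x0, hx0, t, ht, hr⟩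
    cases hx0
    rcases run_zero M t x hr with rfl | ⟨j, u, q, m', hr', rfl, rfl⟩
    · simp [obsW, ow] at ht
    · rw [obs_wd] at ht
      obtain ⟨h1, rfl⟩ := ow_inj ht
      exact ⟨j, u, q, hr', h1, rfl⟩
  · rintro ⟨j, u, q, hr, rfl, rfl⟩
    exact ⟨Sum.inr 0, rfl, _, obs_wd i j u (m + 1), run_zero_mk M j q u (m + 1) hr⟩

theorem run_append {S E : Type*} {δ : S → E → S → Prop} {x y z : S} {u v : List E}
    (h1 : RunRel δ x u y) (h2 : RunRel δ y v z) : RunRel δ x (u ++ v) z := by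
  induction h1 with
  | nil => exact h2
  | cons h _ ih => exact RunRel.cons h (ih h2)

theorem run_det {A P : Type*} (M : PDFA P A) {x y z : P} {u : List A}
    (h1 : RunRel M.step x u y) (h2 : RunRel M.step x u z) : y = z := by
  induction h1 with
  | nil => cases h2; rfl
  | cons h _ ih =>
    cases h2 with
    | cons h' h2' =>
      have := M.deterministic _ _ _ _ h h'
      subst this
      exact ih h2'

theorem len_bound {A P : Type*} [Fintype P] (M : PDFA P A) (hM : M.Acyclic) {x y : P} {u : List A}
    (h : RunRel M.step x u y) : u.length ≤ Fintype.card P := by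
  classical
  let R : P → Set P := fun p => {p' | ∃ w, w ≠ [] ∧ RunRel M.step p w p'}
  have key : u.length ≤ (R x).ncard := by
    induction h with
    | nil => simp
    | @cons x y z e w h _ ih =>
      have : R y ⊂ R x := by
        refine ⟨?_, ?_⟩
        · rintro p ⟨w, _, hr⟩
          exact ⟨e :: w, by simp, RunRel.cons h hr⟩
        · intro hs
          have : y ∈ R y := hs ⟨[e], by simp, RunRel.cons h (RunRel.nil _)⟩
          exact hM ⟨y, this⟩
      have := Set.ncard_lt_ncard this (Set.toFinite _)
      simp only [List.length_cons]
      omega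
  refine key.trans ?_
  rw [← Nat.card_eq_fintype_card]
  exact Set.ncard_le_card _

theorem run_pre {X T Λ : Type*} (A : FSA X T Λ) (x : ℕ → X) (s : ℕ → T)
    (h : ∀ n, A.step (x n) (s n) (x (n + 1))) (n r : ℕ) :
    A.Run (x n) ((List.range' n r).map s) (x (n + r)) := by
  induction r generalizing n with
  | zero => exact RunRel.nil _
  | succ r ih =>
    have := ih (n + 1)
    rw [List.range'_succ, List.map_cons]
    refine RunRel.cons (h n) ?_
    rwa [show n + 1 + r = n + (r + 1) by omega] at this

theorem ext_run {X T Λ : Type*} (A : FSA X T Λ) {x y : X} {t : List T} {a : T}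
    (h : A.Run x t y) (ha : A.step y a y) :
    ∃ (xs : ℕ → X) (s : ℕ → T), xs 0 = x ∧ (∀ n, A.step (xs n) (s n) (xs (n + 1))) ∧
      ∀ m, pre s (t.length + m) = t ++ List.replicate m a := by
  induction h with
  | nil x =>
    refine ⟨fun _ => x, fun _ => a, rfl, fun _ => ha, fun m => ?_⟩
    simp [pre]
  | @cons x y z e w h _ ih =>
    obtain ⟨xs, s, h0, hs, hp⟩ := ih ha
    refine ⟨fun n => Nat.casesOn n x xs, fun n => Nat.casesOn n e s, rfl, ?_, ?_⟩
    · intro n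
      cases n with
      | zero => simpa [h0] using h
      | succ n => exact hs n
    · intro m
      have := hp m
      rw [List.length_cons, show w.length + 1 + m = (w.length + m) + 1 by omega, List.cons_append,
        ← this]
      simp [pre, List.range_succ_eq_map, Function.comp_def]

theorem wd_rep (j : Fin (L + 1)) (u : List Alp) (m r : ℕ) :
    wd j u m ++ List.replicate r evA = wd j u (m + r) := by
  simp [wd]

theorem fwd (M : ∀ i, PDFA (Q i) Alp) (w : List Alp) (hw : ∀ i, (M i).Accepts w) :
    ¬ (sys M).CoDetectable (fun i : Fin L => localObs lbl (obsSet i)) := by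
  rintro ⟨k, hk⟩
  obtain ⟨q0, hr0, ha0⟩ := hw 0
  have hf0 : fend M 0 q0 = Sum.inr 1 := by simp [fend, ha0]
  have hrun := run_zero_mk M 0 q0 w 1 hr0
  obtain ⟨xs, s, h0, hs, hp⟩ := ext_run (sys M) hrun (a := evA)
    (by
      change (sys M).step (fend M 0 q0) evA (fend M 0 q0)
      rw [hf0]; exact (step_fin M 1 (by decide) _ _).2 ⟨rfl, rfl⟩)
  obtain ⟨i, hi⟩ := hk s ⟨xs, by rw [h0]; rfl, hs⟩
  obtain ⟨q1, hr1, -⟩ := hw i.succ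
  have := hi _ (by
    rw [hp k, List.cons_append, wd_rep, obs_wd]
    simp [ow]; omega)
  rw [hp k, List.cons_append, wd_rep, obs_wd, Nat.add_comm 1 k] at this
  obtain ⟨z, hz⟩ := Set.ncard_eq_one.1 this
  have m1 : (Sum.inr 1 : St Q) = z := by
    rw [← Set.mem_singleton_iff, ← hz, mem_est]
    exact ⟨0, w, q0, hr0, rfl, hf0.symm⟩
  have m2 : (Sum.inr 2 : St Q) = z := by
    rw [← Set.mem_singleton_iff, ← hz, mem_est]
    exact ⟨i.succ, w, q1, hr1, by simp [vis], by simp [fend]⟩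
  have := m1.trans m2.symm
  simp at this

theorem bwd (hL : 0 < L) [∀ i, Fintype (Q i)] (M : ∀ i, PDFA (Q i) Alp)
    (hacyc : ∀ i, (M i).Acyclic)
    (hall : ∀ i, i ≠ 0 → (M i).accept = Set.univ)
    (hno : ¬ ∃ w : List Alp, ∀ i, (M i).Accepts w) :
    (sys M).CoDetectable (fun i : Fin L => localObs lbl (obsSet i)) := by
  obtain ⟨N, hN⟩ : ∃ N, ∀ j, Fintype.card (Q j) ≤ N :=
    ⟨∑ j, Fintype.card (Q j), fun j =>
      Finset.single_le_sum (f := fun j => Fintype.card (Q j)) (fun _ _ => Nat.zero_le _)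
        (Finset.mem_univ j)⟩
  refine ⟨N + 2, ?_⟩
  rintro s ⟨xs, hx0, hs⟩
  have hp : ∀ n, pre s n = (List.range' 0 n).map s := fun n => by
    rw [pre, List.range_eq_range']
  have hr := run_pre (sys M) xs s hs 0 (N + 2)
  rw [show xs 0 = Sum.inr 0 from hx0] at hr
  rcases run_zero M _ _ hr with he | ⟨j, w, q, m, hw, he, hx⟩
  · have := congrArg List.length he
    simp at this
  have hlen := (len_bound (M j) (hacyc j) hw).trans (hN j)
  have hm : ∃ m', m = m' + 1 := by
    cases m with
    | succ m' => exact ⟨m', rfl⟩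
    | zero =>
      have := congrArg List.length he
      simp [wd] at this
      omega
  obtain ⟨m', rfl⟩ := hm
  have hnil : ¬ (M 0).Accepts [] := by
    intro h
    refine hno ⟨[], fun i => ?_⟩
    by_cases hi : i = 0
    · subst hi; exact h
    · exact ⟨_, RunRel.nil _, by rw [hall i hi]; trivial⟩
  obtain ⟨i, hi⟩ : ∃ i : Fin L, (M 0).Accepts w → ¬ (M i.succ).Accepts w := by
    by_cases h : (M 0).Accepts w
    · by_contra! hc
      refine hno ⟨w, fun i => ?_⟩
      induction i using Fin.cases with
      | zero => exact h
      | succ i => exact (hc i).2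
    · exact ⟨⟨0, hL⟩, fun h' => absurd h' h⟩
  refine ⟨i, fun n hn => ?_⟩
  have hn' : N + 2 ≤ n := by
    refine hn.trans ((List.length_filterMap_le _ _).trans ?_)
    simp [pre]
  obtain ⟨r, rfl⟩ := Nat.exists_eq_add_of_le hn'
  have hr2 := run_pre (sys M) xs s hs (N + 2) r
  rw [← Nat.zero_add (N + 2), hx] at hr2
  obtain ⟨c, hc, hce⟩ := fend_eq M j q
  change (sys M).Run (fend M j q) _ _ at hr2
  rw [hce] at hr2
  obtain ⟨⟨r', hr'⟩, -⟩ := (run_fin M c hc _ _).1 hr2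
  have hpre : pre s (N + 2 + r) = Sum.inr (Sum.inl j) :: wd j w (m' + r' + 1) := by
    rw [hp, show m' + r' + 1 = m' + 1 + r' by omega, ← wd_rep, ← List.cons_append, ← he, ← hr',
      ← List.map_append, Nat.zero_add]
    congr 1
    have := List.range'_append (s := 0) (m := N + 2) (n := r) (step := 1)
    simpa using this.symm
  dsimp only
  rw [hpre, obs_wd]
  have hne : fend M j q ∈ (sys M).est (localObs lbl (obsSet i)) (ow (vis i j w) (m' + r' + 1)) :=
    (mem_est M i _ _ _).2 ⟨j, w, q, hw, rfl, rfl⟩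
  rw [Set.ncard_eq_one]
  suffices H : ∃ z, ∀ x ∈ (sys M).est (localObs lbl (obsSet i)) (ow (vis i j w) (m' + r' + 1)),
      x = z by
    obtain ⟨z, hz⟩ := H
    exact ⟨z, Set.eq_singleton_iff_unique_mem.2 ⟨hz _ hne ▸ hne, hz⟩⟩
  by_cases hv : (M 0).Accepts (vis i j w)
  · refine ⟨Sum.inr 1, fun x hx => ?_⟩
    obtain ⟨j', u, q', hu, hvu, rfl⟩ := (mem_est M i _ _ _).1 hx
    have hvw : vis i j w = w := by
      unfold vis at hv ⊢
      split_ifs at hv ⊢ with h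
      · rfl
      · exact absurd hv hnil
    rw [hvw] at hv hvu
    have huw : u = w ∧ (j' = 0 ∨ j' = i.succ) := by
      unfold vis at hvu
      split_ifs at hvu with h
      · exact ⟨hvu, h⟩
      · rw [← hvu] at hv
        exact absurd hv hnil
    obtain ⟨rfl, rfl | rfl⟩ := huw
    · obtain ⟨q2, hq2, ha⟩ := hv
      have := run_det _ hu hq2
      subst this
      simp [fend, ha]
    · exact absurd ⟨q', hu, by rw [hall _ (Fin.succ_ne_zero i)]; trivial⟩ (hi hv)
  · refine ⟨Sum.inr 2, fun x hx => ?_⟩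
    obtain ⟨j', u, q', hu, hvu, rfl⟩ := (mem_est M i _ _ _).1 hx
    unfold fend
    rw [if_neg]
    rintro ⟨rfl, ha⟩
    apply hv
    rw [← hvu]
    exact ⟨q', by simpa [vis] using hu, ha⟩

end CoDetRed
end DES

open DES in
/-- Theorem 3 (reduction): for acyclic DFAs `A_0, …, A_L` over a common
alphabet such that `A_0` has exactly one accepting state and all states of
each `A_i` (`i ∈ [1, L]`) are accepting, some word is accepted by every `A_i`
iff the constructed deterministic FSA `S` is not O-co-detectable. -/
theorem dfa_intersection_iff_not_coDetectable
    {L : ℕ} (hL : 0 < L) {Alp : Type} {Q : Fin (L + 1) → Type}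
    [Fintype Alp] [∀ i, Fintype (Q i)]
    (M : ∀ i, PDFA (Q i) Alp)
    (hacyc : ∀ i, (M i).Acyclic)
    (h0 : ∃ q, (M 0).accept = {q})
    (hall : ∀ i, i ≠ 0 → (M i).accept = Set.univ) :
    (∃ w : List Alp, ∀ i, (M i).Accepts w) ↔
    ¬ (CoDetRed.sys M).CoDetectable
        (fun i : Fin L => localObs CoDetRed.lbl (CoDetRed.obsSet i)) := by
  constructor
  · rintro ⟨w, hw⟩
    exact CoDetRed.fwd M w hw
  · intro h
    by_contra hno
    exact h (CoDetRed.bwd hL M hacyc hall hno)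
end
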